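/- (Covering numbers of an ellipsoid.) Let n ≥ 1 and a = (a₁,…,aₙ) with aᵢ > 0 for all i, and let E_a = { θ ∈ ℝⁿ : Σᵢ θᵢ²/aᵢ² ≤ 1 }. Then for every r > 0, log N(E_a, 5r) ≤ Σ_{i : aᵢ ≥ 2r} log( aᵢ / r ) ≤ log N(E_a, r). -/

import Mathlib

open MeasureTheory ENNReal Real Set

noncomputable section

/-- The ellipsoid `E_a = {θ ∈ ℝⁿ : Σᵢ θᵢ²/aᵢ² ≤ 1}`. -/
def ellipsoid (n : ℕ) (a : Fin n → ℝ) : Set (EuclideanSpace ℝ (Fin n)) :=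
  {θ | ∑ i, θ i ^ 2 / a i ^ 2 ≤ 1}

/-- The covering number `N(A, r)`: the least number of closed balls of radius `r` with
centers in `A` needed to cover `A` (`∞` if no finite cover exists). -/
def coveringNumber (n : ℕ) (A : Set (EuclideanSpace ℝ (Fin n))) (r : ℝ) : ℝ≥0∞ :=
  sInf {N : ℝ≥0∞ | ∃ s : Finset (EuclideanSpace ℝ (Fin n)),
    ↑s ⊆ A ∧ (s.card : ℝ≥0∞) = N ∧ A ⊆ ⋃ θ ∈ s, Metric.closedBall θ r}

/-- Comparison of real factors of the volume of the unit ball. -/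
lemma le_of_ofReal_mul_volume_closedBall_le {ι : Type*} [Fintype ι] {u v : ℝ} (hv : 0 ≤ v)
    (h : ENNReal.ofReal u * volume (Metric.closedBall (0 : EuclideanSpace ℝ ι) 1) ≤
      ENNReal.ofReal v * volume (Metric.closedBall (0 : EuclideanSpace ℝ ι) 1)) : u ≤ v := by
  have h0 : volume (Metric.closedBall (0 : EuclideanSpace ℝ ι) 1) ≠ 0 :=
    (Metric.measure_closedBall_pos volume _ one_pos).ne'
  have h1 : volume (Metric.closedBall (0 : EuclideanSpace ℝ ι) 1) ≠ ⊤ :=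
    measure_closedBall_lt_top.ne
  rw [ENNReal.mul_le_mul_iff_left h0 h1] at h
  exact (ENNReal.ofReal_le_ofReal_iff hv).1 h

lemma sum_volume_closedBall {ι : Type*} [Fintype ι]
    (s : Finset (EuclideanSpace ℝ ι)) {ρ : ℝ} (hρ : 0 ≤ ρ) :
    ∑ x ∈ s, volume (Metric.closedBall x ρ) =
      ENNReal.ofReal (s.card * ρ ^ Fintype.card ι) *
        volume (Metric.closedBall (0 : EuclideanSpace ℝ ι) 1) := by
  simp_rw [fun x : EuclideanSpace ℝ ι => Measure.addHaar_closedBall' volume x hρ]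
  rw [Finset.sum_const, nsmul_eq_mul, finrank_euclideanSpace,
    ENNReal.ofReal_mul (Nat.cast_nonneg _), ENNReal.ofReal_natCast, mul_assoc]

/-- The linear map multiplying the `i`-th coordinate by `a i`. -/
def diagonalScaling {ι : Type*} [Fintype ι] [DecidableEq ι] (a : ι → ℝ) :
    EuclideanSpace ℝ ι →ₗ[ℝ] EuclideanSpace ℝ ι :=
  Matrix.toLpLin 2 2 (Matrix.diagonal a)

section Scaling

variable {ι : Type*} [Fintype ι] [DecidableEq ι]

lemma diagonalScaling_apply (a : ι → ℝ) (x : EuclideanSpace ℝ ι) (i : ι) :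
    diagonalScaling a x i = a i * x i := by
  simp [diagonalScaling, Matrix.toLpLin_apply, Matrix.mulVec_diagonal]

lemma volume_image_diagonalScaling {a : ι → ℝ} (ha : ∀ i, 0 < a i) {ρ : ℝ} (hρ : 0 ≤ ρ) :
    volume (diagonalScaling a '' Metric.closedBall 0 ρ) =
      ENNReal.ofReal ((∏ i, a i) * ρ ^ Fintype.card ι) *
        volume (Metric.closedBall (0 : EuclideanSpace ℝ ι) 1) := by
  have hprod : 0 ≤ ∏ i, a i := Finset.prod_nonneg fun i _ => (ha i).le
  rw [Measure.addHaar_image_linearMap, diagonalScaling, LinearMap.det_toLpLin,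
    Matrix.det_diagonal, abs_of_nonneg hprod, Measure.addHaar_closedBall' _ _ hρ,
    finrank_euclideanSpace, ENNReal.ofReal_mul hprod, mul_assoc]

/-- The image of a centred ball under a diagonal scaling, in coordinates. -/
lemma mem_image_diagonalScaling_iff {a : ι → ℝ} (ha : ∀ i, 0 < a i) {ρ : ℝ} (hρ : 0 ≤ ρ)
    (x : EuclideanSpace ℝ ι) :
    x ∈ diagonalScaling a '' Metric.closedBall 0 ρ ↔ ∑ i, x i ^ 2 / a i ^ 2 ≤ ρ ^ 2 := by
  constructor
  · rintro ⟨y, hy, rfl⟩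
    rw [mem_closedBall_zero_iff] at hy
    calc ∑ i, diagonalScaling a y i ^ 2 / a i ^ 2 = ∑ i, y i ^ 2 := by
          refine Finset.sum_congr rfl fun i _ => ?_
          have := (ha i).ne'
          rw [diagonalScaling_apply]
          field_simp
      _ = ‖y‖ ^ 2 := (EuclideanSpace.real_norm_sq_eq y).symm
      _ ≤ ρ ^ 2 := by gcongr
  · intro hx
    refine ⟨WithLp.toLp 2 fun i => x i / a i, ?_, ?_⟩
    · rw [mem_closedBall_zero_iff]
      refine le_of_sq_le_sq ?_ hρ
      simpa [EuclideanSpace.real_norm_sq_eq, div_pow] using hx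
    · ext i
      have := (ha i).ne'
      rw [diagonalScaling_apply]
      field_simp

/-- Volume lower bound on the size of a cover of an ellipsoid. -/
lemma prod_le_card_mul_pow_of_cover {a : ι → ℝ} (ha : ∀ i, 0 < a i) {r : ℝ} (hr : 0 ≤ r)
    (s : Finset (EuclideanSpace ℝ ι))
    (hs : {x : EuclideanSpace ℝ ι | ∑ i, x i ^ 2 / a i ^ 2 ≤ 1} ⊆
      ⋃ x ∈ s, Metric.closedBall x r) :
    ∏ i, a i ≤ s.card * r ^ Fintype.card ι := by
  refine le_of_ofReal_mul_volume_closedBall_le (ι := ι) (by positivity) ?_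
  have hvol := volume_image_diagonalScaling ha zero_le_one
  rw [one_pow, mul_one] at hvol
  rw [← hvol, ← sum_volume_closedBall s hr]
  refine (measure_mono fun x hx => hs ?_).trans (measure_biUnion_finset_le s _)
  simpa using (mem_image_diagonalScaling_iff ha zero_le_one x).1 hx

/-- Volume upper bound on the size of a separated subset of an ellipsoid. -/
lemma card_mul_pow_le_prod_of_separated {a : ι → ℝ} {r : ℝ} (hr : 0 < r)
    (ha : ∀ i, 2 * r ≤ a i) (s : Finset (EuclideanSpace ℝ ι))
    (hs : ∀ x ∈ s, ∑ i, x i ^ 2 / a i ^ 2 ≤ 1)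
    (hsep : ∀ x ∈ s, ∀ y ∈ s, x ≠ y → 4 * r < dist x y) :
    s.card * r ^ Fintype.card ι ≤ ∏ i, a i := by
  have ha0 : ∀ i, 0 < a i := fun i => by linarith [ha i]
  have hprod : 0 < ∏ i, a i := Finset.prod_pos fun i _ => ha0 i
  have hsmall : Metric.closedBall (0 : EuclideanSpace ℝ ι) (2 * r) ⊆
      diagonalScaling a '' Metric.closedBall 0 1 := by
    intro x hx
    rw [mem_closedBall_zero_iff] at hx
    rw [mem_image_diagonalScaling_iff ha0 zero_le_one]
    calc ∑ i, x i ^ 2 / a i ^ 2 ≤ ∑ i, x i ^ 2 / (2 * r) ^ 2 := by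
          gcongr with i
          exact ha i
      _ = ‖x‖ ^ 2 / (2 * r) ^ 2 := by
          rw [EuclideanSpace.real_norm_sq_eq, Finset.sum_div]
      _ ≤ 1 ^ 2 := by
          rw [one_pow, div_le_one (by positivity)]
          gcongr
  have hsub : ⋃ x ∈ s, Metric.closedBall x (2 * r) ⊆
      diagonalScaling a '' Metric.closedBall 0 2 := by
    refine iUnion₂_subset fun x hx y hy => ?_
    obtain ⟨u, hu, hux⟩ := (mem_image_diagonalScaling_iff ha0 zero_le_one x).2
      (by simpa using hs x hx)
    obtain ⟨v, hv, hvy⟩ := hsmall (show y - x ∈ Metric.closedBall 0 (2 * r) by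
      rwa [mem_closedBall_zero_iff, ← dist_eq_norm])
    rw [mem_closedBall_zero_iff] at hu hv
    refine ⟨u + v, ?_, by rw [map_add, hux, hvy, add_sub_cancel]⟩
    rw [mem_closedBall_zero_iff]
    linarith [norm_add_le u v]
  have hdisj : (s : Set (EuclideanSpace ℝ ι)).PairwiseDisjoint
      fun x => Metric.closedBall x (2 * r) := fun x hx y hy hxy =>
    Metric.closedBall_disjoint_closedBall (by linarith [hsep x hx y hy hxy])
  have hle : s.card * (2 * r) ^ Fintype.card ι ≤ (∏ i, a i) * 2 ^ Fintype.card ι := by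
    refine le_of_ofReal_mul_volume_closedBall_le (ι := ι) (by positivity) ?_
    rw [← volume_image_diagonalScaling ha0 zero_le_two,
      ← sum_volume_closedBall s (by positivity : 0 ≤ 2 * r),
      ← measure_biUnion_finset hdisj fun x _ => Metric.isClosed_closedBall.measurableSet]
    exact measure_mono hsub
  rw [mul_pow, mul_left_comm, mul_comm (∏ i, a i)] at hle
  exact le_of_mul_le_mul_left hle (by positivity)

/-- A maximal separated subset of an ellipsoid is an internal cover of controlled size. -/
lemma exists_cover_card_mul_pow_le_prod {a : ι → ℝ} {r : ℝ} (hr : 0 < r)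
    (ha : ∀ i, 2 * r ≤ a i) :
    ∃ s : Finset (EuclideanSpace ℝ ι), (∀ x ∈ s, ∑ i, x i ^ 2 / a i ^ 2 ≤ 1) ∧
      s.card * r ^ Fintype.card ι ≤ ∏ i, a i ∧
      ∀ x : EuclideanSpace ℝ ι, ∑ i, x i ^ 2 / a i ^ 2 ≤ 1 → ∃ y ∈ s, dist x y ≤ 4 * r := by
  classical
  let P : Finset (EuclideanSpace ℝ ι) → Prop := fun s =>
    (∀ x ∈ s, ∑ i, x i ^ 2 / a i ^ 2 ≤ 1) ∧ ∀ x ∈ s, ∀ y ∈ s, x ≠ y → 4 * r < dist x y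
  let K : Set ℕ := {k | ∃ s, P s ∧ s.card = k}
  have hbdd : BddAbove K := by
    refine ⟨⌊(∏ i, a i) / r ^ Fintype.card ι⌋₊, ?_⟩
    rintro k ⟨s, hs, rfl⟩
    refine Nat.le_floor ?_
    rw [le_div_iff₀ (by positivity)]
    exact card_mul_pow_le_prod_of_separated hr ha s hs.1 hs.2
  have hne : K.Nonempty := ⟨0, ∅, by simp [P], rfl⟩
  obtain ⟨s, hs, hcard⟩ := Nat.sSup_mem hne hbdd
  refine ⟨s, hs.1, card_mul_pow_le_prod_of_separated hr ha s hs.1 hs.2, fun x hx => ?_⟩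
  by_contra! hfar
  have hxs : x ∉ s := fun h => by
    have := hfar x h
    rw [dist_self] at this
    linarith
  have hP : P (insert x s) := by
    refine ⟨fun y hy => ?_, fun y hy z hz hyz => ?_⟩
    · rcases Finset.mem_insert.1 hy with rfl | hy
      exacts [hx, hs.1 y hy]
    · rcases Finset.mem_insert.1 hy with rfl | hys <;>
        rcases Finset.mem_insert.1 hz with rfl | hzs
      · exact absurd rfl hyz
      · exact hfar z hzs
      · rw [dist_comm]
        exact hfar y hys
      · exact hs.2 y hys z hzs hyz
  have hle := le_csSup hbdd (show (insert x s).card ∈ K from ⟨_, hP, rfl⟩)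
  rw [Finset.card_insert_of_notMem hxs] at hle
  omega

end Scaling

section Coordinates

variable {ι : Type*} (p : ι → Prop)

/-- Restriction of a vector to the coordinates satisfying `p`. -/
def restrictCoords (x : EuclideanSpace ℝ ι) : EuclideanSpace ℝ {i // p i} :=
  WithLp.toLp 2 fun i => x i

lemma restrictCoords_apply (x : EuclideanSpace ℝ ι) (i : {i // p i}) :
    restrictCoords p x i = x i := rfl

variable [DecidablePred p]

/-- Extension by zero of a vector indexed by the coordinates satisfying `p`. -/
def extendCoords (x : EuclideanSpace ℝ {i // p i}) : EuclideanSpace ℝ ι :=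
  WithLp.toLp 2 fun i => if h : p i then x ⟨i, h⟩ else 0

lemma extendCoords_apply_of_pos (x : EuclideanSpace ℝ {i // p i}) (i : {i // p i}) :
    extendCoords p x i = x i := by
  simp [extendCoords, i.2]

lemma extendCoords_apply_of_neg (x : EuclideanSpace ℝ {i // p i}) (i : {i // ¬ p i}) :
    extendCoords p x i = 0 := by
  simp [extendCoords, i.2]

lemma restrictCoords_extendCoords (x : EuclideanSpace ℝ {i // p i}) :
    restrictCoords p (extendCoords p x) = x := by
  ext i
  rw [restrictCoords_apply, extendCoords_apply_of_pos]

variable [Fintype ι]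

lemma dist_restrictCoords_le (x y : EuclideanSpace ℝ ι) :
    dist (restrictCoords p x) (restrictCoords p y) ≤ dist x y := by
  rw [EuclideanSpace.dist_eq, EuclideanSpace.dist_eq,
    ← Fintype.sum_subtype_add_sum_subtype p fun i => dist (x i) (y i) ^ 2]
  exact Real.sqrt_le_sqrt (le_add_of_nonneg_right (Finset.sum_nonneg fun i _ => sq_nonneg _))

lemma dist_extendCoords_sq (x : EuclideanSpace ℝ ι) (y : EuclideanSpace ℝ {i // p i}) :
    dist x (extendCoords p y) ^ 2 =
      dist (restrictCoords p x) y ^ 2 + ∑ i : {i // ¬ p i}, x i ^ 2 := by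
  rw [EuclideanSpace.dist_sq_eq, EuclideanSpace.dist_sq_eq,
    ← Fintype.sum_subtype_add_sum_subtype p fun i => dist (x i) (extendCoords p y i) ^ 2]
  simp_rw [extendCoords_apply_of_pos, extendCoords_apply_of_neg, restrictCoords_apply]
  simp

lemma sum_extendCoords (a : ι → ℝ) (x : EuclideanSpace ℝ {i // p i}) :
    ∑ i, extendCoords p x i ^ 2 / a i ^ 2 = ∑ i : {i // p i}, x i ^ 2 / a i ^ 2 := by
  rw [← Fintype.sum_subtype_add_sum_subtype p fun i => extendCoords p x i ^ 2 / a i ^ 2]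
  simp_rw [extendCoords_apply_of_pos, extendCoords_apply_of_neg]
  simp

end Coordinates

lemma ofReal_prod_le_coveringNumber {n : ℕ} {a : Fin n → ℝ} (ha : ∀ i, 0 < a i) {r : ℝ}
    (hr : 0 < r) (p : Fin n → Prop) [DecidablePred p] :
    ENNReal.ofReal (∏ i : {i // p i}, a i / r) ≤ coveringNumber n (ellipsoid n a) r := by
  classical
  refine le_sInf ?_
  rintro _ ⟨s, -, rfl, hs⟩
  have hcover : {x : EuclideanSpace ℝ {i // p i} | ∑ i, x i ^ 2 / a i ^ 2 ≤ 1} ⊆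
      ⋃ x ∈ s.image (restrictCoords p), Metric.closedBall x r := by
    intro x hx
    have hmem : extendCoords p x ∈ ellipsoid n a := by
      rw [ellipsoid, mem_ofPred_eq, sum_extendCoords]
      exact hx
    obtain ⟨θ, hθ, hdist⟩ := mem_iUnion₂.1 (hs hmem)
    refine mem_iUnion₂.2 ⟨restrictCoords p θ, Finset.mem_image_of_mem _ hθ, ?_⟩
    rw [Metric.mem_closedBall, ← restrictCoords_extendCoords p x]
    exact (dist_restrictCoords_le p _ _).trans hdist
  have hprod := prod_le_card_mul_pow_of_cover (fun i : {i // p i} => ha i) hr.le _ hcover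
  rw [← ENNReal.ofReal_natCast]
  refine ENNReal.ofReal_le_ofReal ?_
  rw [Finset.prod_div_distrib, Finset.prod_const, Finset.card_univ, div_le_iff₀ (by positivity)]
  refine hprod.trans ?_
  gcongr
  exact Finset.card_image_le

lemma coveringNumber_le_ofReal_prod {n : ℕ} {a : Fin n → ℝ} (ha : ∀ i, 0 < a i) {r : ℝ}
    (hr : 0 < r) :
    coveringNumber n (ellipsoid n a) (5 * r) ≤
      ENNReal.ofReal (∏ i : {i // 2 * r ≤ a i}, a i / r) := by
  classical
  set p : Fin n → Prop := fun i => 2 * r ≤ a i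
  obtain ⟨s, hsub, hcard, hs⟩ :=
    exists_cover_card_mul_pow_le_prod (a := fun i : {i // p i} => a i) hr fun i => i.2
  have hcover : ∃ t : Finset (EuclideanSpace ℝ (Fin n)), ↑t ⊆ ellipsoid n a ∧
      (t.card : ℝ≥0∞) = (s.image (extendCoords p)).card ∧
      ellipsoid n a ⊆ ⋃ θ ∈ t, Metric.closedBall θ (5 * r) := by
    refine ⟨s.image (extendCoords p), ?_, rfl, fun x hx => ?_⟩
    · intro θ hθ
      obtain ⟨x, hx, rfl⟩ := Finset.mem_image.1 (Finset.mem_coe.1 hθ)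
      rw [ellipsoid, mem_ofPred_eq, sum_extendCoords]
      exact hsub x hx
    · rw [ellipsoid, mem_ofPred_eq,
        ← Fintype.sum_subtype_add_sum_subtype p fun i => x i ^ 2 / a i ^ 2] at hx
      have hpos : 0 ≤ ∑ i : {i // p i}, x i ^ 2 / a i ^ 2 :=
        Finset.sum_nonneg fun i _ => by positivity
      have hneg : 0 ≤ ∑ i : {i // ¬ p i}, x i ^ 2 / a i ^ 2 :=
        Finset.sum_nonneg fun i _ => by positivity
      obtain ⟨y, hy, hxy⟩ := hs (restrictCoords p x) (by
        simp_rw [restrictCoords_apply]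
        linarith)
      have htail : ∑ i : {i // ¬ p i}, x i ^ 2 ≤ (2 * r) ^ 2 := by
        calc ∑ i : {i // ¬ p i}, x i ^ 2
            ≤ ∑ i : {i // ¬ p i}, (2 * r) ^ 2 * (x i ^ 2 / a i ^ 2) := by
              refine Finset.sum_le_sum fun i _ => ?_
              have hai := ha i
              have hlt : a i ≤ 2 * r := (not_le.1 i.2).le
              rw [← mul_div_assoc, le_div_iff₀ (by positivity), mul_comm]
              gcongr
          _ = (2 * r) ^ 2 * ∑ i : {i // ¬ p i}, x i ^ 2 / a i ^ 2 := by rw [Finset.mul_sum]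
          _ ≤ (2 * r) ^ 2 * 1 := by
              gcongr
              linarith
          _ = (2 * r) ^ 2 := mul_one _
      refine mem_iUnion₂.2 ⟨extendCoords p y, Finset.mem_image_of_mem _ hy, ?_⟩
      rw [Metric.mem_closedBall]
      refine le_of_sq_le_sq ?_ (by positivity)
      rw [dist_extendCoords_sq]
      have hsq : dist (restrictCoords p x) y ^ 2 ≤ (4 * r) ^ 2 := by gcongr
      nlinarith
  have hle : coveringNumber n (ellipsoid n a) (5 * r) ≤ (s.image (extendCoords p)).card :=
    sInf_le hcover
  refine hle.trans ?_
  rw [← ENNReal.ofReal_natCast]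
  refine ENNReal.ofReal_le_ofReal ?_
  rw [Finset.prod_div_distrib, Finset.prod_const, Finset.card_univ, le_div_iff₀ (by positivity)]
  refine le_trans ?_ hcard
  gcongr
  exact Finset.card_image_le

/-- Covering numbers of an ellipsoid: for every `r > 0`,
`log N(E_a, 5r) ≤ Σ_{i : aᵢ ≥ 2r} log(aᵢ/r) ≤ log N(E_a, r)`. -/
theorem coveringNumber_ellipsoid (n : ℕ) (hn : 1 ≤ n) (a : Fin n → ℝ)
    (ha : ∀ i, 0 < a i) (r : ℝ) (hr : 0 < r) :
    ENNReal.log (coveringNumber n (ellipsoid n a) (5 * r)) ≤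
      ((∑ i ∈ Finset.univ.filter fun i => 2 * r ≤ a i, Real.log (a i / r) : ℝ) : EReal) ∧
    ((∑ i ∈ Finset.univ.filter fun i => 2 * r ≤ a i, Real.log (a i / r) : ℝ) : EReal) ≤
      ENNReal.log (coveringNumber n (ellipsoid n a) r) := by
  have hpos : ∀ i : {i // 2 * r ≤ a i}, 0 < a i / r := fun i => div_pos (ha i) hr
  have hlog : ((∑ i ∈ Finset.univ.filter fun i => 2 * r ≤ a i, Real.log (a i / r) : ℝ) : EReal) =
      ENNReal.log (ENNReal.ofReal (∏ i : {i // 2 * r ≤ a i}, a i / r)) := by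
    rw [ENNReal.log_ofReal_of_pos (Finset.prod_pos fun i _ => hpos i),
      Real.log_prod fun i _ => (hpos i).ne', ← Finset.sum_subtype_eq_sum_filter,
      Finset.subtype_univ]
  rw [hlog]
  exact ⟨ENNReal.log_le_log (coveringNumber_le_ofReal_prod ha hr),
    ENNReal.log_le_log (ofReal_prod_le_coveringNumber ha hr _)⟩
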